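/- arXiv:1506.07489 — 3 statements merged into one kernel-verified Lean document; each statement's English description precedes it below -/
import Mathlib

section
/- Let $k$ be an algebraically closed field of characteristic zero, $K$ a field extension of $k$, and let $u_1,u_2,v_1,v_2,w_1,w_2 \in K$ be algebraically independent over $k$. Define $t_{i,j,k} := (u_i+v_j)/(v_j+w_k)$ for $i,j,k \in \{1,2\}$. Then the intermediate field $k(t_{i,j,k} \mid i,j,k \in \{1,2\})$ has transcendence degree exactly $4$ over $k$. -/
/-- An intermediate field generated by a family is algebraic over the subalgebra generated by that
family. -/
lemma isAlgebraic_algebraAdjoin_of_le_adjoin {F E ι : Type*} [Field F] [Field E] [Algebra F E]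
    {L : IntermediateField F E} {x : ι → L}
    (hL : L ≤ IntermediateField.adjoin F (Set.range fun i ↦ (x i : E))) :
    Algebra.IsAlgebraic (Algebra.adjoin F (Set.range x)) L := by
  refine ⟨fun y ↦ ?_⟩
  have hy : y ∈ IntermediateField.adjoin F (Set.range x) := by
    have h := hL y.2
    have hrange : (Set.range fun i ↦ (x i : E)) = L.val '' Set.range x := by
      rw [← Set.range_comp]; rfl
    rw [hrange, ← IntermediateField.adjoin_map] at h
    obtain ⟨z, hz, hzy⟩ := h
    rwa [← Subtype.ext hzy]
  induction hy using IntermediateField.adjoin_induction with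
  | mem z hz =>
    exact isAlgebraic_algebraMap (⟨z, Algebra.subset_adjoin hz⟩ : Algebra.adjoin F (Set.range x))
  | algebraMap r =>
    exact isAlgebraic_algebraMap (algebraMap F (Algebra.adjoin F (Set.range x)) r)
  | add _ _ _ _ h₁ h₂ => exact h₁.add h₂
  | inv _ _ h => exact h.inv
  | mul _ _ _ _ h₁ h₂ => exact h₁.mul h₂

/-- A finite family of field elements which generates an algebraically independent family with the
same index type is itself algebraically independent. -/
lemma AlgebraicIndependent.of_mem_adjoin_range {F E ι : Type*} [Field F] [Field E] [Algebra F E]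
    [Finite ι] {x y : ι → E} (hx : AlgebraicIndependent F x)
    (h : ∀ i, x i ∈ IntermediateField.adjoin F (Set.range y)) : AlgebraicIndependent F y := by
  let L := IntermediateField.adjoin F (Set.range y)
  let x' : ι → L := fun i ↦ ⟨x i, h i⟩
  let y' : ι → L := fun i ↦ ⟨y i, IntermediateField.subset_adjoin F _ ⟨i, rfl⟩⟩
  have hx' : AlgebraicIndependent F x' := .of_comp L.val hx
  have : Algebra.IsAlgebraic (Algebra.adjoin F (Set.range y')) L :=
    isAlgebraic_algebraAdjoin_of_le_adjoin le_rfl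
  exact (Algebra.IsAlgebraic.isTranscendenceBasis_of_lift_le_trdeg_of_finite F y'
    hx'.lift_cardinalMk_le_trdeg).1.map' (f := L.val) L.val.injective

lemma AlgebraicIndependent.add_ne_zero {R A ι : Type*} [CommRing R] [Nontrivial R] [CommRing A]
    [Algebra R A] {x : ι → A} (hx : AlgebraicIndependent R x) {i j : ι} (hij : i ≠ j) :
    x i + x j ≠ 0 := by
  intro h
  have := (LinearIndepOn.pair_iff x hij).mp (hx.linearIndependent.linearIndepOn _) 1 1
    (by simpa using h)
  exact one_ne_zero this.1

/-- If `u₁,u₂,v₁,v₂,w₁,w₂ ∈ K` are algebraically independent over an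
algebraically closed field `k` of characteristic zero, then the intermediate field
generated over `k` by the eight elements `t i j l = (uᵢ+vⱼ)/(vⱼ+wₗ)` has transcendence
degree exactly `4` over `k` (i.e. it admits a transcendence basis indexed by `Fin 4`). -/
theorem twisted_cube_trdeg_four {k K : Type*} [Field k] [IsAlgClosed k] [CharZero k]
    [Field K] [Algebra k K] (u₁ u₂ v₁ v₂ w₁ w₂ : K)
    (hind : AlgebraicIndependent k ![u₁, u₂, v₁, v₂, w₁, w₂]) :
    ∃ b : Fin 4 → (IntermediateField.adjoin k
        {(u₁ + v₁) / (v₁ + w₁), (u₁ + v₁) / (v₁ + w₂),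
         (u₁ + v₂) / (v₂ + w₁), (u₁ + v₂) / (v₂ + w₂),
         (u₂ + v₁) / (v₁ + w₁), (u₂ + v₁) / (v₁ + w₂),
         (u₂ + v₂) / (v₂ + w₁), (u₂ + v₂) / (v₂ + w₂)} : IntermediateField k K),
      IsTranscendenceBasis k b := by
  have ha : v₁ + w₁ ≠ 0 := hind.add_ne_zero (i := 2) (j := 4) (by decide)
  have huv : u₁ + v₁ ≠ 0 := hind.add_ne_zero (i := 0) (j := 2) (by decide)
  have hvw : v₂ + w₁ ≠ 0 := hind.add_ne_zero (i := 3) (j := 4) (by decide)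
  have huw : u₁ - w₁ ≠ 0 :=
    sub_ne_zero.mpr (hind.injective.ne (show (0 : Fin 6) ≠ 4 by decide))
  let c : Fin 4 → K := ![(u₁ + v₁) / (v₁ + w₁), (u₂ + v₁) / (v₁ + w₁),
    (v₁ + w₂) / (v₁ + w₁), (v₂ - v₁) / (v₁ + w₁)]
  have hc : AlgebraicIndependent k c := by
    let e : Fin 6 → K := ![c 0, c 1, c 2, c 3, v₁ + w₁, v₁]
    have he (i : Fin 6) : e i ∈ IntermediateField.adjoin k (Set.range e) :=
      IntermediateField.subset_adjoin k _ ⟨i, rfl⟩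
    have hmul (i : Fin 6) : e i * (v₁ + w₁) ∈ IntermediateField.adjoin k (Set.range e) :=
      mul_mem (he i) (he 4)
    have hind' : AlgebraicIndependent k e := by
      refine hind.of_mem_adjoin_range fun i ↦ ?_
      fin_cases i
      · convert sub_mem (hmul 0) (he 5) using 1
        simp [e, c, ha]
      · convert sub_mem (hmul 1) (he 5) using 1
        simp [e, c, ha]
      · exact he 5
      · convert add_mem (hmul 3) (he 5) using 1
        simp [e, c, ha]
      · convert sub_mem (he 4) (he 5) using 1
        simp [e]
      · convert sub_mem (hmul 2) (he 5) using 1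
        simp [e, c, ha]
    have hle : 4 ≤ 6 := by decide
    convert hind'.comp (Fin.castLE hle) (Fin.castLE_injective hle) using 1
    ext i
    fin_cases i <;> rfl
  set T : Set K := {(u₁ + v₁) / (v₁ + w₁), (u₁ + v₁) / (v₁ + w₂),
         (u₁ + v₂) / (v₂ + w₁), (u₁ + v₂) / (v₂ + w₂),
         (u₂ + v₁) / (v₁ + w₁), (u₂ + v₁) / (v₁ + w₂),
         (u₂ + v₂) / (v₂ + w₁), (u₂ + v₂) / (v₂ + w₂)} with hT
  have hcT (i : Fin 4) : c i ∈ IntermediateField.adjoin k T := by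
    have hmem {t : K} (ht : t ∈ T) : t ∈ IntermediateField.adjoin k T :=
      IntermediateField.subset_adjoin k _ ht
    have h₀ : (u₁ + v₁) / (v₁ + w₁) ∈ IntermediateField.adjoin k T := hmem (by simp [hT])
    fin_cases i
    · exact h₀
    · exact hmem (by simp [c, hT])
    · have h : (u₁ + v₁) / (v₁ + w₂) ∈ IntermediateField.adjoin k T := hmem (by simp [hT])
      convert div_mem h₀ h using 1
      simp only [c]
      exact (div_div_div_cancel_left' _ _ huv).symm
    · have h : (u₁ + v₂) / (v₂ + w₁) ∈ IntermediateField.adjoin k T := hmem (by simp [hT])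
      convert div_mem (sub_mem h₀ h) (sub_mem h (one_mem _)) using 1
      have h₁ : (u₁ + v₂) / (v₂ + w₁) - 1 = (u₁ - w₁) / (v₂ + w₁) := by
        field_simp
        ring
      rw [h₁]
      change (v₂ - v₁) / (v₁ + w₁) = _
      field_simp
      ring
  have hTc : IntermediateField.adjoin k T ≤ IntermediateField.adjoin k (Set.range c) := by
    have hmem (i : Fin 4) : c i ∈ IntermediateField.adjoin k (Set.range c) :=
      IntermediateField.subset_adjoin k _ ⟨i, rfl⟩
    have of_div {p q : K} (hp : p / (v₁ + w₁) ∈ IntermediateField.adjoin k (Set.range c))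
        (hq : q / (v₁ + w₁) ∈ IntermediateField.adjoin k (Set.range c)) :
        p / q ∈ IntermediateField.adjoin k (Set.range c) := by
      simpa [div_div_div_cancel_right₀ ha] using div_mem hp hq
    have shift {p q : K} (hp : p / (v₁ + w₁) ∈ IntermediateField.adjoin k (Set.range c))
        (hpq : p + (v₂ - v₁) = q) : q / (v₁ + w₁) ∈ IntermediateField.adjoin k (Set.range c) := by
      rw [← hpq, add_div]
      exact add_mem hp (hmem 3)
    have hu₁ := hmem 0
    have hu₂ := hmem 1
    have hw₂ := hmem 2
    have hw₁ : (v₁ + w₁) / (v₁ + w₁) ∈ IntermediateField.adjoin k (Set.range c) := by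
      simp [ha]
    have hu₁' := shift (q := u₁ + v₂) hu₁ (by ring)
    have hu₂' := shift (q := u₂ + v₂) hu₂ (by ring)
    have hw₁' := shift (q := v₂ + w₁) hw₁ (by ring)
    have hw₂' := shift (q := v₂ + w₂) hw₂ (by ring)
    rw [IntermediateField.adjoin_le_iff]
    rintro t (rfl | rfl | rfl | rfl | rfl | rfl | rfl | rfl)
    exacts [of_div hu₁ hw₁, of_div hu₁ hw₂, of_div hu₁' hw₁', of_div hu₁' hw₂',
      of_div hu₂ hw₁, of_div hu₂ hw₂, of_div hu₂' hw₁', of_div hu₂' hw₂']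
  let b : Fin 4 → IntermediateField.adjoin k T := fun i ↦ ⟨c i, hcT i⟩
  have hb : AlgebraicIndependent k b := .of_comp (IntermediateField.adjoin k T).val hc
  exact ⟨b, hb.isTranscendenceBasis_iff_isAlgebraic.mpr
    (isAlgebraic_algebraAdjoin_of_le_adjoin hTc)⟩
end

section
/- Let $k$ be an algebraically closed field of characteristic zero, $K$ a field extension of $k$, and let $u_1,u_2,u_3 \in K$ be algebraically independent over $k$. Let $u_3' \in K$ be algebraic over $k(u_3)$. If $u_1\cdot(u_2+u_3')$ is algebraic over the subfield $k\big(u_1\cdot(u_2+u_3)\big)$, then $u_3' = u_3$. -/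
open AlgebraicIndependent IntermediateField

/-- Algebraically independent elements cannot all be algebraic over a smaller generating set. -/
theorem AlgebraicIndependent.encard_range_le_of_isAlgebraic {ι k K : Type*} [Field k] [Field K]
    [Algebra k K] {x : ι → K} (hx : AlgebraicIndependent k x) {s : Set K}
    (hs : ∀ i, IsAlgebraic (adjoin k s) (x i)) : (Set.range x).encard ≤ s.encard := by
  have hsub : Set.range x ⊆ (matroid k K).closure s := by
    rintro _ ⟨i, rfl⟩
    rw [matroid_closure_eq, SetLike.mem_coe, Subalgebra.mem_algebraicClosure]
    exact isAlgebraic_adjoin_iff.mp (hs i)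
  rw [← (matroid_indep_iff.mpr hx.to_subtype_range).eRk_eq_encard]
  exact ((matroid k K).eRk_mono hsub).trans
    (((matroid k K).eRk_closure_eq s).trans_le ((matroid k K).eRk_le_encard s))

/-- If `u₁,u₂,u₃ ∈ K` are algebraically independent over the
algebraically closed field `k` of characteristic zero, `u₃'` is algebraic over
`k(u₃)`, and `u₁(u₂+u₃')` is algebraic over `k(u₁(u₂+u₃))`, then `u₃' = u₃`. -/
theorem field_form_conjugate_fixed {k K : Type*} [Field k] [IsAlgClosed k] [CharZero k]
    [Field K] [Algebra k K] (u₁ u₂ u₃ u₃' : K)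
    (hind : AlgebraicIndependent k ![u₁, u₂, u₃])
    (halg : IsAlgebraic (IntermediateField.adjoin k {u₃} : IntermediateField k K) u₃')
    (h : IsAlgebraic (IntermediateField.adjoin k
        {u₁ * (u₂ + u₃)} : IntermediateField k K) (u₁ * (u₂ + u₃'))) :
    u₃' = u₃ := by
  by_contra hne
  have hd : u₃' - u₃ ≠ 0 := sub_ne_zero.mpr hne
  have hu₁ : u₁ ≠ 0 := hind.ne_zero 0
  set s := u₁ * (u₂ + u₃) with hs
  let S : Set K := {u₃, s}
  have mem_alg {x : K} (hx : x ∈ S) : IsAlgebraic (adjoin k S) x :=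
    isAlgebraic_algebraMap (⟨x, subset_adjoin k S hx⟩ : adjoin k S)
  have mono_alg {T : Set K} (hT : T ⊆ S) {x : K} (hx : IsAlgebraic (adjoin k T) x) :
      IsAlgebraic (adjoin k S) x :=
    hx.tower_top_of_subalgebra_le (adjoin.mono k T S hT)
  have alg₃ := mem_alg (x := u₃) (by simp [S])
  have algs := mem_alg (x := s) (by simp [S])
  have alg₃' := mono_alg (by simp [S]) halg
  have algt := mono_alg (by simp [S]) h
  have alg₁ : IsAlgebraic (adjoin k S) u₁ := by
    have : u₁ = (u₁ * (u₂ + u₃') - s) * (u₃' - u₃)⁻¹ := by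
      rw [eq_mul_inv_iff_mul_eq₀ hd, hs]; ring
    rw [this]
    exact (algt.sub algs).mul (alg₃'.sub alg₃).inv
  have alg₂ : IsAlgebraic (adjoin k S) u₂ := by
    have : u₂ = s * u₁⁻¹ - u₃ := by rw [hs]; field_simp; ring
    rw [this]
    exact (algs.mul alg₁.inv).sub alg₃
  have hcard := hind.encard_range_le_of_isAlgebraic (s := S) fun i ↦ by
    fin_cases i
    exacts [alg₁, alg₂, alg₃]
  rw [← Set.image_univ, hind.injective.encard_image, Set.encard_univ] at hcard
  have := hcard.trans (Set.encard_insert_le {s} u₃)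
  norm_num [Set.encard_singleton] at this
end

section
/- Let $k$ be an algebraically closed field of characteristic zero, $K$ a field extension of $k$, and let $u_1,u_2,u_3 \in K$ be algebraically independent over $k$. Let $u_3' \in K$ be algebraic over $k(u_3)$. If $\frac{u_3'+u_2}{u_2+u_1}$ is algebraic over the subfield $k\big(\frac{u_3+u_2}{u_2+u_1}\big)$, then $u_3' = u_3$. -/
/-- In characteristic zero, a derivation of a field extension may be prescribed arbitrarily on a
transcendence basis. -/
theorem IsTranscendenceBasis.exists_derivation {k K ι : Type*} [Field k] [CharZero k]
    [Field K] [Algebra k K] {v : ι → K} (hv : IsTranscendenceBasis k v) (f : ι → K) :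
    ∃ D : Derivation k K K, ∀ i, D (v i) = f i := by
  let S := MvPolynomial ι k
  let φ : S →ₐ[k] K := MvPolynomial.aeval v
  let : Algebra S K := φ.toAlgebra
  have : IsScalarTower k S K := .of_algHom φ
  have : FaithfulSMul S K := (faithfulSMul_iff_algebraMap_injective S K).2 hv.1
  have : Algebra.IsAlgebraic S K := by
    have := hv.isAlgebraic
    exact .of_ringHom_of_comp_eq hv.1.aevalEquiv.toAlgHom (RingHom.id K)
      hv.1.aevalEquiv.surjective Function.injective_id (RingHom.ext hv.1.algebraMap_aevalEquiv)
  let : Algebra (FractionRing S) K := FractionRing.liftAlgebra S K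
  have : IsScalarTower S (FractionRing S) K := FractionRing.isScalarTower_liftAlgebra S K
  have : Algebra.IsAlgebraic (FractionRing S) K :=
    (IsFractionRing.comap_isAlgebraic_iff (A := S) (K := FractionRing S) (C := K)).1 inferInstance
  have : Algebra.FormallyEtale (FractionRing S) K := Algebra.FormallyEtale.of_isSeparable _ _
  have : Algebra.FormallyEtale S (FractionRing S) :=
    .of_isLocalization (nonZeroDivisors S)
  have : Algebra.FormallyEtale S K := .comp S (FractionRing S) K
  let d : Derivation k S K := MvPolynomial.mkDerivation k f
  let l := (KaehlerDifferential.isBaseChange_of_formallyEtale k S K).lift d.liftKaehlerDifferential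
  refine ⟨l.compDer (KaehlerDifferential.D k K), fun i ↦ ?_⟩
  have hi : v i = algebraMap S K (MvPolynomial.X i) := (MvPolynomial.aeval_X v i).symm
  have h := (KaehlerDifferential.isBaseChange_of_formallyEtale k S K).lift_eq
    d.liftKaehlerDifferential (KaehlerDifferential.D k S (MvPolynomial.X i))
  rw [KaehlerDifferential.map_D, Derivation.liftKaehlerDifferential_comp_D] at h
  rw [hi]
  exact h.trans (MvPolynomial.mkDerivation_X k f i)

/-- In characteristic zero, a derivation of a field extension may be prescribed arbitrarily on an
algebraically independent family. -/
theorem AlgebraicIndependent.exists_derivation {k K ι : Type*} [Field k] [CharZero k]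
    [Field K] [Algebra k K] {v : ι → K} (hv : AlgebraicIndependent k v) (f : ι → K) :
    ∃ D : Derivation k K K, ∀ i, D (v i) = f i := by
  obtain ⟨t, hst, ht⟩ := exists_isTranscendenceBasis_superset hv.coe_range
  obtain ⟨D, hD⟩ := ht.exists_derivation
    (fun x ↦ Function.extend v f 0 x)
  exact ⟨D, fun i ↦ (hD ⟨v i, hst ⟨i, rfl⟩⟩).trans (hv.injective.extend_apply f 0 i)⟩

/-- In characteristic zero, a derivation that kills `a` kills everything algebraic over `k(a)`. -/
theorem Derivation.eq_zero_of_isAlgebraic_adjoin_singleton {k K : Type*} [Field k] [CharZero k]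
    [Field K] [Algebra k K] (D : Derivation k K K) {a x : K} (ha : D a = 0)
    (hx : IsAlgebraic (IntermediateField.adjoin k {a}) x) : D x = 0 := by
  have hE : ∀ y ∈ IntermediateField.adjoin k {a}, D y = 0 := fun y hy ↦ by
    induction hy using IntermediateField.adjoin_induction with
    | mem y hy => rwa [Set.mem_singleton_iff.1 hy]
    | algebraMap r => exact D.map_algebraMap r
    | add y z _ _ hy hz => simp [hy, hz]
    | mul y z _ _ hy hz => simp [hy, hz]
    | inv y _ hy => simp [Derivation.leibniz_inv, hy]
  let D' : Derivation (IntermediateField.adjoin k {a}) K K :=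
    .mk' { toFun := D
           map_add' := D.map_add
           map_smul' := fun c y ↦ by
            simp [Algebra.smul_def, IntermediateField.algebraMap_apply, hE c c.2] } D.leibniz
  have h := D'.map_aeval (minpoly _ x) x
  rw [minpoly.aeval, D'.map_zero, eq_comm, smul_eq_zero] at h
  exact h.resolve_left
    ((minpoly.irreducible hx.isIntegral).separable.aeval_derivative_ne_zero (minpoly.aeval _ x))

/-- If `u₁,u₂,u₃ ∈ K` are algebraically independent over the
algebraically closed field `k` of characteristic zero, `u₃'` is algebraic over
`k(u₃)`, and `(u₃'+u₂)/(u₂+u₁)` is algebraic over `k((u₃+u₂)/(u₂+u₁))`, then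
`u₃' = u₃`. -/
theorem twisted_form_conjugate_fixed {k K : Type*} [Field k] [IsAlgClosed k] [CharZero k]
    [Field K] [Algebra k K] (u₁ u₂ u₃ u₃' : K)
    (hind : AlgebraicIndependent k ![u₁, u₂, u₃])
    (halg : IsAlgebraic (IntermediateField.adjoin k {u₃} : IntermediateField k K) u₃')
    (h : IsAlgebraic (IntermediateField.adjoin k
        {(u₃ + u₂) / (u₂ + u₁)} : IntermediateField k K) ((u₃' + u₂) / (u₂ + u₁))) :
    u₃' = u₃ := by
  have hne : u₂ + u₁ ≠ 0 := fun h0 ↦ by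
    have := hind.linearIndependent
    rw [Fintype.linearIndependent_iff] at this
    have := this ![1, 1, 0] (by simpa [Fin.sum_univ_three, add_comm] using h0) 0
    simp at this
  obtain ⟨D, hD⟩ := hind.exists_derivation ![u₁ - u₃, u₃ + u₂, 0]
  have h1 : D u₁ = u₁ - u₃ := hD 0
  have h2 : D u₂ = u₃ + u₂ := hD 1
  have h3 : D u₃ = 0 := hD 2
  have h3' : D u₃' = 0 := D.eq_zero_of_isAlgebraic_adjoin_singleton h3 halg
  have ht : D ((u₃ + u₂) / (u₂ + u₁)) = 0 := by
    simp only [Derivation.leibniz_div, map_add, h1, h2, h3, smul_eq_mul]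
    ring
  have ht' := D.eq_zero_of_isAlgebraic_adjoin_singleton ht h
  simp only [Derivation.leibniz_div, map_add, h1, h2, h3', smul_eq_mul] at ht'
  have : (u₂ + u₁)⁻¹ ^ 2 * ((u₂ + u₁) * (u₃ - u₃')) = 0 := by rw [← ht']; ring
  exact (sub_eq_zero.1 (by simpa [hne] using this)).symm
end
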